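/- If T is a closed operator and N is a normal operator with dom(N) ⊆ dom(T) and TN ⊆ NT, then for every x in dom(TN*) we have x ∈ dom(N*T), i.e., dom(TN*) ⊆ dom(N*T). -/

import Mathlib

open LinearPMap

/-- Composition of partial linear maps: `T.pcomp S` is "first `S`, then `T`", with
domain `{x ∈ dom S : S x ∈ dom T}`. -/
noncomputable def LinearPMap.pcomp {H : Type*} [NormedAddCommGroup H] [InnerProductSpace ℂ H]
    (T S : H →ₗ.[ℂ] H) : H →ₗ.[ℂ] H where
  domain := (Submodule.comap S.toFun T.domain).map S.domain.subtype
  toFun := T.toFun ∘ₗ (S.toFun.restrict fun _ hx => hx) ∘ₗ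
    (Submodule.equivMapOfInjective S.domain.subtype S.domain.injective_subtype
      (Submodule.comap S.toFun T.domain)).symm.toLinearMap

/-- A densely defined closed operator `N` on a complex Hilbert space is normal if
`N* N = N N*` (as partial linear maps). -/
noncomputable def LinearPMap.IsNormalOp {H : Type*} [NormedAddCommGroup H]
    [InnerProductSpace ℂ H] [CompleteSpace H] (N : H →ₗ.[ℂ] H) : Prop :=
  Dense (N.domain : Set H) ∧ N.IsClosed ∧ N.adjoint.pcomp N = N.pcomp N.adjoint

/-- A bounded everywhere-defined operator viewed as a partial linear map. -/
noncomputable def ContinuousLinearMap.toPMapTop {H : Type*} [NormedAddCommGroup H]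
    [InnerProductSpace ℂ H] (A : H →L[ℂ] H) : H →ₗ.[ℂ] H :=
  (A : H →ₗ[ℂ] H).toPMap ⊤

variable {H : Type*} [NormedAddCommGroup H] [InnerProductSpace ℂ H] [CompleteSpace H]

theorem twisted_aux {A : Type*} [Ring A] {Q C D S f h : A}
    (hQC : Q * C = C * Q) (hQD : Q * D = D * Q) (hfQ : f * Q = Q * f) (hhQ : h * Q = Q * h)
    (hfh : f * h = h * f) (hfC : f * C = C * f) (hfD : f * D = D * f) (hhC : h * C = C * h)
    (hhD : h * D = D * h) (hfhQ : f * h * Q = f) (hS : Q * S * C = C * S * Q)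
    (hfug : (f * S * f) * (C * h) = (C * h) * (f * S * f) →
      (f * S * f) * (h * D) = (h * D) * (f * S * f)) :
    f * (Q * S * D) * f = f * (D * S * Q) * f := by
  have h1 : (f * S * f) * (C * h) = (C * h) * (f * S * f) := by
    calc (f * S * f) * (C * h) = f * S * (f * C) * h := by simp only [mul_assoc]
      _ = (f * h * Q) * S * (C * f) * h := by rw [hfhQ, hfC]
      _ = f * h * (Q * S * C) * f * h := by simp only [mul_assoc]
      _ = f * h * (C * S * Q) * f * h := by rw [hS]
      _ = (f * (h * C)) * S * ((Q * f) * h) := by simp only [mul_assoc]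
      _ = (C * h * f) * S * (f * h * Q) := by
        have e1 : f * (h * C) = C * h * f := by rw [← hhC, ← mul_assoc, hfh, mul_assoc, hfC, mul_assoc]
        have e2 : (Q * f) * h = f * h * Q := by rw [← hfQ, mul_assoc, ← hhQ, mul_assoc]
        rw [e1, e2]
      _ = _ := by rw [hfhQ]; simp only [mul_assoc]
  have h2 := hfug h1
  have e3 : D * f = f * h * D * Q := by
    rw [mul_assoc (f*h), ← hQD, ← mul_assoc, hfhQ, hfD]
  have e4 : f * D = Q * (h * D * f) := by
    calc f * D = D * (f * h * Q) := by rw [hfhQ, hfD]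
      _ = D * f * h * Q := by simp only [mul_assoc]
      _ = Q * (h * D * f) := by
        have : h * D * f = D * f * h := by rw [hhD, mul_assoc, ← hfh, mul_assoc]
        rw [this]
        have : Q * (D * f * h) = D * f * h * Q := by
          rw [← mul_assoc, ← mul_assoc, hQD, mul_assoc D, ← hfQ, mul_assoc, mul_assoc f, ← hhQ]
          simp only [mul_assoc]
        rw [this]
  calc f * (Q * S * D) * f = (f * Q) * S * (D * f) := by simp only [mul_assoc]
    _ = Q * ((f * S * f) * (h * D)) * Q := by rw [e3, hfQ]; simp only [mul_assoc]
    _ = (Q * (h * D * f)) * S * (f * Q) := by rw [h2]; simp only [mul_assoc]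
    _ = _ := by rw [← e4, hfQ]; simp only [mul_assoc]

theorem twisted_fuglede {A : Type*} [CStarAlgebra A] {Q C S : A} (hQ : IsSelfAdjoint Q)
    (hpos : ∀ t ∈ spectrum ℝ Q, 0 ≤ t) (hC : IsStarNormal C) (hQC : Commute Q C)
    (hS : Q * S * C = C * S * Q) :
    Q * (Q * S * star C) * Q = Q * (star C * S * Q) * Q := by
  have hQD : Commute Q (star C) := by
    have := hQC.star_star
    rwa [hQ.star_eq] at this
  have key : ∀ ε : ℝ, 0 < ε → ∃ f : A, ‖f - Q‖ ≤ ε ∧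
      f * (Q * S * star C) * f = f * (star C * S * Q) * f := by
    intro ε hε
    have hc1 : Continuous (fun t : ℝ => max (t - ε) 0) := by fun_prop
    have hne : ∀ t : ℝ, max t ε ≠ 0 := fun t => (lt_of_lt_of_le hε (le_max_right _ _)).ne'
    have hc2 : Continuous (fun t : ℝ => (max t ε)⁻¹) :=
      Continuous.inv₀ (by fun_prop) hne
    set f : A := cfc (fun t : ℝ => max (t - ε) 0) Q with hf
    set h : A := cfc (fun t : ℝ => (max t ε)⁻¹) Q with hh
    have hhs : IsSelfAdjoint h := cfc_predicate _ _
    have cfa : ∀ B : A, Commute Q B → Commute f B := fun B hB => hB.cfc_real _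
    have cha : ∀ B : A, Commute Q B → Commute h B := fun B hB => hB.cfc_real _
    refine ⟨f, ?_, ?_⟩
    · have : f - Q = cfc (fun t : ℝ => max (t - ε) 0 - t) Q := by
        rw [cfc_sub (fun t : ℝ => max (t - ε) 0) (fun t => t) Q hc1.continuousOn (by fun_prop),
          cfc_id' ℝ Q]
      rw [this]
      refine norm_cfc_le hε.le ?_
      intro t ht
      have := hpos t ht
      rw [Real.norm_eq_abs, abs_le]
      constructor
      · linarith [le_max_left (t-ε) 0]
      · have : max (t-ε) 0 ≤ t := max_le (by linarith) this
        linarith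
    · refine twisted_aux (h := h) hQC.eq hQD.eq (cfa Q (.refl _)).eq (cha Q (.refl _)).eq
        (cfa h (cha Q (.refl _)).symm).eq (cfa C hQC).eq (cfa _ hQD).eq (cha C hQC).eq
        (cha _ hQD).eq ?_ hS ?_
      · conv_lhs => rw [← cfc_id' ℝ Q, hf, hh]
        rw [cfc_id' ℝ Q]
        nth_rw 3 [← cfc_id' ℝ Q]
        rw [← cfc_mul _ _ Q hc1.continuousOn hc2.continuousOn,
          ← cfc_mul (fun t : ℝ => max (t - ε) 0 * (max t ε)⁻¹) (fun t => t) Q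
            (hc1.mul hc2).continuousOn (by fun_prop)]
        rw [hf]
        congr 1
        funext t
        rcases le_total t ε with h1 | h1
        · rw [max_eq_right (by linarith : t - ε ≤ 0)]; simp
        · rw [max_eq_left h1, mul_assoc, inv_mul_cancel₀ (by linarith : t ≠ 0), mul_one]
      · intro hcomm
        have hst : star (C * h) = h * star C := by rw [star_mul, hhs.star_eq]
        have hM : IsStarNormal (C * h) := by
          constructor
          rw [hst]
          have c1 := (cha C hQC).eq
          have c2 := (cha _ hQD).eq
          have c3 := hC.star_comm_self.eq
          change h * star C * (C * h) = C * h * (h * star C)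
          calc h * star C * (C * h) = h * (star C * C) * h := by simp only [mul_assoc]
            _ = (h * C) * (star C * h) := by rw [c3]; simp only [mul_assoc]
            _ = _ := by rw [c1, ← c2]
        have := hM.commute_star_right (x := f * S * f) hcomm
        rw [hst] at this
        exact this.eq
  choose! f hf1 hf2 using key
  have ht : Filter.Tendsto (fun n : ℕ => f (1 / ((n : ℝ) + 1))) Filter.atTop (nhds Q) := by
    rw [tendsto_iff_norm_sub_tendsto_zero]
    refine squeeze_zero (fun _ => norm_nonneg _) (fun n => hf1 _ (by positivity)) ?_
    exact tendsto_one_div_add_atTop_nhds_zero_nat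
  refine tendsto_nhds_unique ((ht.mul_const _).mul ht) ?_
  refine ((ht.mul_const (star C * S * Q)).mul ht).congr fun n => ?_
  exact (hf2 _ (by positivity)).symm


theorem exists_bdd_comp {T : H →ₗ.[ℂ] H} (hT : T.IsClosed) (A : H →L[ℂ] H)
    (hA : ∀ x, A x ∈ T.domain) : ∃ S : H →L[ℂ] H, ∀ x, (A x, S x) ∈ T.graph := by
  let g : H →ₗ[ℂ] H := T.toFun ∘ₗ (A.toLinearMap.codRestrict T.domain hA)
  have hg : ∀ x, (A x, g x) ∈ T.graph := fun x => T.mem_graph ⟨A x, hA x⟩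
  have hcl : _root_.IsClosed (g.graph : Set (H × H)) := by
    have : (g.graph : Set (H × H)) = (fun p : H × H => (A p.1, p.2)) ⁻¹' (T.graph : Set (H × H)) := by
      ext ⟨a, b⟩
      simp only [SetLike.mem_coe, LinearMap.mem_graph_iff, Set.mem_preimage]
      constructor
      · rintro rfl; exact hg a
      · intro h; exact T.mem_graph_snd_inj h (hg a) rfl
    rw [this]
    exact IsClosed.preimage (by fun_prop) hT
  exact ⟨ContinuousLinearMap.ofIsClosedGraph hcl, hg⟩

theorem exists_phase (C : H →L[ℂ] H) (hC : IsStarNormal C) :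
    ∃ W : H →L[ℂ] H, W * C = star C ∧ C * W = star C ∧
      ∀ S : H →L[ℂ] H, Commute S C → Commute S (star C) → Commute S W := by
  have hn : ∀ x, ‖C x‖ = ‖(star C) x‖ :=
    ContinuousLinearMap.isStarNormal_iff_norm_eq_adjoint.mp hC
  let K : Submodule ℂ H := (LinearMap.range C.toLinearMap).topologicalClosure
  have hCK : ∀ x, C x ∈ K := fun x => Submodule.le_topologicalClosure _ ⟨x, rfl⟩
  have : CompleteSpace K := (Submodule.isClosed_topologicalClosure _).completeSpace_coe
  let e : H →ₗ[ℂ] K := C.toLinearMap.codRestrict K hCK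
  have hd : DenseRange e := by
    rw [DenseRange, dense_iff_closure_eq, Set.eq_univ_iff_forall]
    rintro ⟨y, hy⟩
    rw [closure_subtype]
    have : (Subtype.val '' Set.range e : Set H) = Set.range C := by
      rw [← Set.range_comp]; rfl
    rw [this]
    exact hy
  have hno : ∃ c : ℝ, ∀ x, ‖(star C).toLinearMap x‖ ≤ c * ‖e x‖ := ⟨1, fun x => by
    rw [one_mul]; exact (hn x).symm.le⟩
  let V := (star C).toLinearMap.extendOfNorm e
  let W : H →L[ℂ] H := V ∘L K.orthogonalProjectionOnto
  have hW1 : ∀ x, W (C x) = star C x := by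
    intro x
    have : K.orthogonalProjectionOnto (C x) = e x :=
      Submodule.orthogonalProjectionOnto_mem_subspace_eq_self (e x)
    change V (K.orthogonalProjectionOnto _) = _
    rw [this]
    exact LinearMap.extendOfNorm_eq hd hno x
  have hker : ∀ x, x ∈ Kᗮ → W x = 0 := by
    intro x hx
    change V (K.orthogonalProjectionOnto _) = _
    rw [Submodule.orthogonalProjectionOnto_apply_of_mem_orthogonal hx, _root_.map_zero]
  have hperp : ∀ x, x ∈ Kᗮ ↔ C x = 0 := by
    intro x
    rw [Submodule.orthogonal_closure, ← norm_eq_zero, hn, norm_eq_zero]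
    have := ContinuousLinearMap.orthogonal_range C
    rw [this]
    rfl
  have hext : ∀ A B : H →L[ℂ] H, A * C = B * C → (∀ x, C x = 0 → A x = B x) → A = B := by
    intro A B h1 h2
    have hK : ∀ x ∈ K, A x = B x := by
      intro x hx
      have : K ≤ LinearMap.eqLocus A.toLinearMap B.toLinearMap := by
        refine Submodule.topologicalClosure_minimal _ ?_ (isClosed_eq A.continuous B.continuous)
        rintro _ ⟨z, rfl⟩
        exact congrArg (fun F : H →L[ℂ] H => F z) h1
      exact this hx
    ext x
    obtain ⟨y, hy, z, hz, rfl⟩ := K.exists_add_mem_mem_orthogonal x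
    rw [_root_.map_add, _root_.map_add, hK y hy, h2 z ((hperp z).1 hz)]
  have hWC : W * C = star C := by ext x; exact hW1 x
  have hcomm : ∀ S : H →L[ℂ] H, Commute S C → Commute S (star C) → Commute S W := by
    intro S h1 h2
    refine hext _ _ ?_ ?_
    · rw [mul_assoc, hWC, mul_assoc, h1.eq, ← mul_assoc, hWC, h2.eq]
    · intro x hx
      change S (W x) = W (S x)
      rw [hker x ((hperp x).2 hx), _root_.map_zero, hker]
      rw [hperp]
      have : C (S x) = S (C x) := congrArg (fun F : H →L[ℂ] H => F x) h1.eq.symm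
      rw [this, hx, _root_.map_zero]
  refine ⟨W, hWC, ?_, hcomm⟩
  rw [(hcomm C (.refl _) hC.star_comm_self.symm).eq, hWC]

theorem mem_pcomp_graph {H : Type*} [NormedAddCommGroup H] [InnerProductSpace ℂ H]
    (T S : H →ₗ.[ℂ] H) (a b : H) :
    (a, b) ∈ (T.pcomp S).graph ↔ ∃ c, (a, c) ∈ S.graph ∧ (c, b) ∈ T.graph := by
  have key : ∀ (x : S.domain) (hx : S x ∈ T.domain) (hx' : (x : H) ∈ (T.pcomp S).domain),
      (T.pcomp S) ⟨x, hx'⟩ = T ⟨S x, hx⟩ := by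
    intro x hx hx'
    have : (Submodule.equivMapOfInjective S.domain.subtype S.domain.injective_subtype
      (Submodule.comap S.toFun T.domain)).symm ⟨x, hx'⟩ = ⟨x, hx⟩ := by
      rw [LinearEquiv.symm_apply_eq]
      rfl
    change T.toFun ((S.toFun.restrict (p := Submodule.comap S.toFun T.domain)
      (q := T.domain) fun _ hx => hx) ((Submodule.equivMapOfInjective S.domain.subtype
      S.domain.injective_subtype (Submodule.comap S.toFun T.domain)).symm ⟨x, hx'⟩)) = _
    rw [this]
    rfl
  constructor
  · intro h
    obtain ⟨⟨y, hy⟩, h1, h2⟩ := (mem_graph_iff _).1 h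
    have hy2 := hy
    obtain ⟨x, hx, hxy⟩ := hy2
    simp only at h1 h2
    subst h1
    subst h2
    have hxy' : (x : H) = y := hxy
    subst hxy'
    exact ⟨S x, S.mem_graph x, by rw [key x hx hy]; exact T.mem_graph ⟨S x, hx⟩⟩
  · rintro ⟨c, h1, h2⟩
    obtain ⟨x, hx1, hx2⟩ := (mem_graph_iff _).1 h1
    obtain ⟨z, hz1, hz2⟩ := (mem_graph_iff _).1 h2
    simp only at hx1 hx2 hz1 hz2
    subst hx1
    subst hx2
    have hx : S x ∈ T.domain := hz1 ▸ z.2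
    have hx' : (x : H) ∈ (T.pcomp S).domain := ⟨x, hx, rfl⟩
    have : b = (T.pcomp S) ⟨x, hx'⟩ := by
      rw [key x hx, ← hz2]
      congr 1
      exact Subtype.ext hz1
    rw [this]
    exact (T.pcomp S).mem_graph ⟨x, hx'⟩

/-- von Neumann: the operators `Q = (1 + N* N)⁻¹` and `C = N Q`. -/
theorem exists_QC (N : H →ₗ.[ℂ] H) (hd : Dense (N.domain : Set H)) (hc : N.IsClosed) :
    ∃ Q C : H →L[ℂ] H, IsSelfAdjoint Q ∧ (∀ t ∈ spectrum ℝ Q, 0 ≤ t) ∧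
      (∀ x, (Q x, C x) ∈ N.graph) ∧ (∀ x, (C x, x - Q x) ∈ N.adjoint.graph) := by
  let L := WithLp.prodContinuousLinearEquiv 2 ℂ H H
  let G : Submodule ℂ (WithLp 2 (H × H)) := N.graph.comap (L : WithLp 2 (H × H) →ₗ[ℂ] H × H)
  have hG : IsClosed (G : Set (WithLp 2 (H × H))) := IsClosed.preimage L.continuous hc
  have : CompleteSpace G := hG.completeSpace_coe
  let J : H →L[ℂ] WithLp 2 (H × H) :=
    (L.symm : H × H →L[ℂ] WithLp 2 (H × H)) ∘L ContinuousLinearMap.inl ℂ H H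
  let P := G.starProjection
  let R : H →L[ℂ] H × H := (L : WithLp 2 (H × H) →L[ℂ] H × H) ∘L P ∘L J
  let Q : H →L[ℂ] H := ContinuousLinearMap.fst ℂ H H ∘L R
  let C : H →L[ℂ] H := ContinuousLinearMap.snd ℂ H H ∘L R
  have h1 : ∀ x, (Q x, C x) ∈ N.graph := fun x => G.starProjection_apply_mem (J x)
  have h2 : ∀ x a b, (a, b) ∈ N.graph → inner ℂ (x - Q x) a = inner ℂ (C x) b := by
    intro x a b hab
    have := G.starProjection_inner_eq_zero (J x) (L.symm (a, b)) hab
    rw [WithLp.prod_inner_apply] at this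
    change inner ℂ (x - Q x) a + inner ℂ (0 - C x) b = 0 at this
    rw [zero_sub, inner_neg_left] at this
    linear_combination this
  have h3 : ∀ x, (C x, x - Q x) ∈ N.adjoint.graph := by
    intro x
    rw [LinearPMap.adjoint_graph_eq_graph_adjoint hd, Submodule.mem_adjoint_iff]
    intro a b hab
    have := congrArg (starRingEnd ℂ) (h2 x a b hab)
    rw [inner_conj_symm, inner_conj_symm] at this
    simp [this]
  have h4 : ∀ x y, inner ℂ x (Q y) = inner ℂ (Q x) (Q y) + inner ℂ (C x) (C y) := by
    intro x y
    have := h2 x (Q y) (C y) (h1 y)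
    rw [inner_sub_left] at this
    linear_combination this
  have h5 : ∀ x y, inner ℂ (Q x) y = inner ℂ (Q x) (Q y) + inner ℂ (C x) (C y) := by
    intro x y
    have := congrArg (starRingEnd ℂ) (h4 y x)
    rw [_root_.map_add, inner_conj_symm, inner_conj_symm, inner_conj_symm] at this
    exact this
  have hp : Q.IsPositive := by
    rw [ContinuousLinearMap.isPositive_def]
    refine ⟨fun x y => (h5 x y).trans (h4 x y).symm, fun x => ?_⟩
    rw [ContinuousLinearMap.reApplyInnerSelf, h5, _root_.map_add]
    exact add_nonneg inner_self_nonneg inner_self_nonneg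
  refine ⟨Q, C, hp.isSelfAdjoint, ?_, h1, h3⟩
  intro t ht
  exact spectrum_nonneg_of_nonneg ((ContinuousLinearMap.nonneg_iff_isPositive Q).2 hp) ht

/-- Domain-inclusion part of the generalized Fuglede theorem: if `T` is closed, `N` is normal,
`dom N ⊆ dom T` and `T N ⊆ N T`, then `dom (T N*) ⊆ dom (N* T)`. -/
theorem fuglede_closed_domain_inclusion (T N : H →ₗ.[ℂ] H)
    (hTc : T.IsClosed) (hTd : Dense (T.domain : Set H)) (hN : N.IsNormalOp)
    (hdom : N.domain ≤ T.domain)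
    (h : T.pcomp N ≤ N.pcomp T) :
    (T.pcomp N.adjoint).domain ≤ (N.adjoint.pcomp T).domain := by
  obtain ⟨hd, hc, hnorm⟩ := hN
  have H1 : ∀ a b, (∃ c, (a, c) ∈ N.graph ∧ (c, b) ∈ N.adjoint.graph) ↔
      ∃ c, (a, c) ∈ N.adjoint.graph ∧ (c, b) ∈ N.graph := by
    intro a b
    rw [← mem_pcomp_graph, ← mem_pcomp_graph, hnorm]
  have hT : ∀ a b c d, (a, b) ∈ N.graph → (a, c) ∈ T.graph → (b, d) ∈ T.graph →
      (c, d) ∈ N.graph := by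
    intro a b c d hab hac hbd
    have := le_graph_of_le h ((mem_pcomp_graph T N a d).2 ⟨b, hab, hbd⟩)
    obtain ⟨c', h1, h2⟩ := (mem_pcomp_graph N T a d).1 this
    rwa [T.mem_graph_snd_inj hac h1 rfl]
  obtain ⟨Q, C, hQ, hpos, hn1, hm1⟩ := exists_QC N hd hc
  have hQsym : ∀ x y, inner ℂ (Q x) y = inner ℂ x (Q y) :=
    ContinuousLinearMap.isSelfAdjoint_iff_isSymmetric.1 hQ
  have hDl : ∀ x y, inner ℂ (star C x) y = inner ℂ x (C y) :=
    fun x y => ContinuousLinearMap.adjoint_inner_left C y x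
  have hadj : ∀ a b c d, (a, b) ∈ N.graph → (c, d) ∈ N.adjoint.graph →
      inner ℂ c b = inner ℂ d a := by
    intro a b c d h1 h2
    rw [LinearPMap.adjoint_graph_eq_graph_adjoint hd, Submodule.mem_adjoint_iff] at h2
    have := congrArg (starRingEnd ℂ) (sub_eq_zero.1 (h2 a b h1))
    rwa [inner_conj_symm, inner_conj_symm] at this
  have hadj' : ∀ c d, (∀ a b, (a, b) ∈ N.graph → inner ℂ c b = inner ℂ d a) →
      (c, d) ∈ N.adjoint.graph := by
    intro c d h2
    rw [LinearPMap.adjoint_graph_eq_graph_adjoint hd, Submodule.mem_adjoint_iff]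
    intro a b hab
    have := congrArg (starRingEnd ℂ) (h2 a b hab)
    rw [inner_conj_symm, inner_conj_symm] at this
    exact sub_eq_zero.2 this
  have ladd : ∀ (A : H →ₗ.[ℂ] H) (a b c d : H), (a, b) ∈ A.graph → (c, d) ∈ A.graph →
      (a + c, b + d) ∈ A.graph := fun A a b c d h1 h2 => A.graph.add_mem h1 h2
  have lsub : ∀ (A : H →ₗ.[ℂ] H) (a b c d : H), (a, b) ∈ A.graph → (c, d) ∈ A.graph →
      (a - c, b - d) ∈ A.graph := fun A a b c d h1 h2 => A.graph.sub_mem h1 h2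
  -- uniqueness
  have huniq : ∀ u c x, (u, c) ∈ N.graph → (c, x - u) ∈ N.adjoint.graph → u = Q x := by
    intro u c x h1 h2
    have e1 := lsub _ _ _ _ _ h1 (hn1 x)
    have e2 := lsub _ _ _ _ _ h2 (hm1 x)
    have e3 := hadj _ _ _ _ e1 e2
    have e4 : x - u - (x - Q x) = -(u - Q x) := by abel
    rw [e4, inner_neg_left] at e3
    have e5 : RCLike.re (inner ℂ (c - C x) (c - C x)) = - RCLike.re (inner ℂ (u - Q x) (u - Q x)) := by
      rw [e3, _root_.map_neg]
    rw [inner_self_eq_norm_sq, inner_self_eq_norm_sq] at e5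
    have : ‖u - Q x‖ = 0 := by
      have := sq_nonneg ‖c - C x‖
      have := sq_nonneg ‖u - Q x‖
      have : ‖u - Q x‖ ^ 2 = 0 := by linarith
      exact pow_eq_zero_iff (two_ne_zero) |>.1 this
    exact sub_eq_zero.1 (norm_eq_zero.1 this)
  -- Q N ⊆ N Q
  have hn2 : ∀ a b, (a, b) ∈ N.graph → C a = Q b := by
    intro a b hab
    obtain ⟨d, hd1, hd2⟩ := (H1 (C a) (b - C a)).2 ⟨_, hm1 a, lsub _ _ _ _ _ hab (hn1 a)⟩
    exact huniq _ _ _ hd1 hd2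
  have hm2 : ∀ a b, (a, b) ∈ N.adjoint.graph → star C a = Q b := by
    intro a b hab
    refine ext_inner_right ℂ fun v => ?_
    rw [hDl, hQsym]
    exact hadj _ _ _ _ (hn1 v) hab
  have hm3 : ∀ x, (Q x, star C x) ∈ N.adjoint.graph := by
    intro x
    refine hadj' _ _ fun a b hab => ?_
    rw [hDl, hQsym, hn2 a b hab]
  have hn3 : ∀ x, (star C x, x - Q x) ∈ N.graph := by
    intro x
    obtain ⟨c, h1, h2⟩ := (H1 (Q x) (x - Q x)).1 ⟨_, hn1 x, hm1 x⟩
    rwa [N.adjoint.mem_graph_snd_inj (hm3 x) h1 rfl]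
  have cCQ : ∀ x, C (Q x) = Q (C x) := fun x => hn2 _ _ (hn1 x)
  have cDQ : ∀ x, star C (Q x) = Q (star C x) := fun x => hm2 _ _ (hm3 x)
  have hDC : ∀ x, star C (C x) = Q (x - Q x) := fun x => hm2 _ _ (hm1 x)
  have hCD : ∀ x, C (star C x) = Q (x - Q x) := fun x => hn2 _ _ (hn3 x)
  have hCn : IsStarNormal C := ⟨by ext x; exact (hDC x).trans (hCD x).symm⟩
  have hQC : Commute Q C := by ext x; exact (cCQ x).symm
  have hQD : Commute Q (star C) := by ext x; exact (cDQ x).symm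
  have hn4 : ∀ v u, C v = Q u → (v, u) ∈ N.graph := by
    intro v u hvu
    have e1 := hm1 v
    rw [hvu] at e1
    have e2 := N.adjoint.mem_graph_snd_inj e1 (hm3 u) rfl
    have e3 := ladd _ _ _ _ _ (hn1 v) (hn3 u)
    rw [← e2, hvu] at e3
    simpa using e3
  have hm4 : ∀ v u, star C v = Q u → (v, u) ∈ N.adjoint.graph := by
    intro v u hvu
    have e1 := hn3 v
    rw [hvu] at e1
    have e2 := N.mem_graph_snd_inj e1 (hn1 u) rfl
    have e3 := ladd _ _ _ _ _ (hm3 v) (hm1 u)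
    rw [← e2, hvu] at e3
    simpa using e3
  have hQinj : ∀ x y, Q x = Q y → x = y := by
    have h0 : ∀ x, Q x = 0 → x = 0 := by
      intro x hx
      have e1 := hn1 x
      rw [hx] at e1
      have e2 := hm1 x
      rw [N.graph_fst_eq_zero_snd e1 rfl] at e2
      have := N.adjoint.graph_fst_eq_zero_snd e2 rfl
      rwa [hx, sub_zero] at this
    intro x y hxy
    exact sub_eq_zero.1 (h0 _ (by rw [_root_.map_sub, hxy, sub_self]))
  have canL : ∀ A B : H →L[ℂ] H, Q * A = Q * B → A = B := by
    intro A B hAB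
    ext x
    exact hQinj _ _ (congrArg (fun F : H →L[ℂ] H => F x) hAB)
  have canR : ∀ A B : H →L[ℂ] H, A * Q = B * Q → A = B := by
    intro A B hAB
    have := congrArg star hAB
    rw [star_mul, star_mul, hQ.star_eq] at this
    exact star_injective (canL _ _ this)
  -- the bounded operators T Q and T C*
  obtain ⟨S, hS⟩ := exists_bdd_comp hTc Q
    fun x => hdom (mem_domain_of_mem_graph (hn1 x))
  obtain ⟨S', hS'⟩ := exists_bdd_comp hTc (star C)
    fun x => hdom (mem_domain_of_mem_graph (hn3 x))
  have hSC : Q * S * C = C * S * Q := by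
    ext x
    have e1 := hn1 (Q x)
    rw [cCQ] at e1
    exact (hn2 _ _ (hT _ _ _ _ e1 (hS (Q x)) (hS (C x)))).symm
  have hSD : Q * S * star C = star C * S * Q :=
    canL _ _ (canR _ _ (twisted_fuglede hQ hpos hCn hQC hSC))
  have hCDm : C * star C = Q - Q * Q := by
    ext x
    have := hCD x
    rw [_root_.map_sub] at this
    exact this
  have hSQ : Commute S Q := by
    have e1 : Q * Q * S * (C * star C) = (C * star C) * S * (Q * Q) := by
      calc Q * Q * S * (C * star C) = Q * (Q * S * C) * star C := by simp only [mul_assoc]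
        _ = (Q * C) * S * (Q * star C) := by rw [hSC]; simp only [mul_assoc]
        _ = C * (Q * S * star C) * Q := by rw [hQC.eq, hQD.eq]; simp only [mul_assoc]
        _ = _ := by rw [hSD]; simp only [mul_assoc]
    rw [hCDm] at e1
    have e2 : Q * ((Q * S) * Q) = Q * ((S * Q) * Q) := by
      simp only [mul_sub, sub_mul, mul_assoc] at e1 ⊢
      exact sub_left_injective e1
    exact (canR _ _ (canL _ _ e2)).symm
  have hSCc : Commute S C := by
    refine canL _ _ ?_
    rw [← mul_assoc, hSC, mul_assoc, hSQ.eq, ← mul_assoc, ← mul_assoc, hQC.eq]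
  have hSDc : Commute S (star C) := by
    refine canL _ _ ?_
    rw [← mul_assoc, hSD, mul_assoc, hSQ.eq, ← mul_assoc, ← mul_assoc, hQD.eq]
  -- Q T ⊆ T Q on dom N
  have hQS' : Q * S' = S * star C := by
    refine canR _ _ ?_
    ext x
    have e1 := hS' (Q x)
    rw [cDQ] at e1
    have e2 := T.mem_graph_snd_inj e1 (hS (star C x)) rfl
    change Q (S' (Q x)) = S (star C (Q x))
    rw [e2, cDQ]
    exact (congrArg (fun F : H →L[ℂ] H => F (star C x)) hSQ.eq).symm
  have hQT : ∀ z u t, (z, u) ∈ N.graph → (z, t) ∈ T.graph → Q t = S z := by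
    intro z u t hzu hzt
    have e1 := hm1 z
    rw [hn2 _ _ hzu] at e1
    have e2 := N.adjoint.mem_graph_snd_inj e1 (hm3 u) rfl
    have e3 := ladd _ _ _ _ _ (hS z) (hS' u)
    have e4 : Q z + star C u = z := by rw [← e2]; abel
    rw [e4] at e3
    rw [T.mem_graph_snd_inj hzt e3 rfl, _root_.map_add]
    have e5 : Q (S z) = S (Q z) := congrArg (fun F : H →L[ℂ] H => F z) hSQ.eq.symm
    have e6 : Q (S' u) = S (star C u) := congrArg (fun F : H →L[ℂ] H => F u) hQS'
    rw [e5, e6, ← _root_.map_add, e4]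
  obtain ⟨W, hWC, hCW, hWcomm⟩ := exists_phase C hCn
  have hQW := hWcomm Q hQC hQD
  have hSW := hWcomm S hSCc hSDc
  have hCWa : ∀ x, C (W x) = star C x := fun x => congrArg (fun F : H →L[ℂ] H => F x) hCW
  have hWD : star W * star C = C := by rw [← star_mul, hCW, star_star]
  have hQW' : Q * star W = star W * Q := by
    have := congrArg star hQW.eq
    rw [star_mul, star_mul, hQ.star_eq] at this
    exact this.symm
  -- conclusion
  intro x hx
  obtain ⟨ty, hx⟩ := mem_domain_iff.1 hx
  obtain ⟨y, hxy, hyt⟩ := (mem_pcomp_graph _ _ _ _).1 hx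
  have hxN : (x, star W y) ∈ N.graph := by
    refine hn4 _ _ ?_
    have e1 : C x = star W (star C x) := congrArg (fun F : H →L[ℂ] H => F x) hWD.symm
    rw [e1, hm2 _ _ hxy]
    exact congrArg (fun F : H →L[ℂ] H => F y) hQW'.symm
  obtain ⟨tx, htx⟩ := mem_domain_iff.1 (hdom (mem_domain_of_mem_graph hxN))
  have hwN : (W x, y) ∈ N.graph := hn4 _ _ (by rw [hCWa, hm2 _ _ hxy])
  obtain ⟨tw, htw⟩ := mem_domain_iff.1 (hdom (mem_domain_of_mem_graph hwN))
  have e1 := hn2 _ _ (hT _ _ _ _ hwN htw hyt)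
  have e2 := hQT _ _ _ hwN htw
  have e3 := hQT _ _ _ hxN htx
  have e4 : C tw = star C tx := by
    refine hQinj _ _ ?_
    rw [← cCQ, ← cDQ, e2, e3]
    have e5 : S (W x) = W (S x) := congrArg (fun F : H →L[ℂ] H => F x) hSW.eq
    rw [e5, hCWa]
  have e6 := hm4 tx ty (by rw [← e4, e1])
  exact mem_domain_iff.2 ⟨ty, (mem_pcomp_graph _ _ _ _).2 ⟨tx, htx, e6⟩⟩
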